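/- Let μ be a probability measure on ℝ^d, δ > 0, and x, y ∈ ℝ^d. Define the sublevel set L_{μ,δ} = {z ∈ ℝ^d : d_μ(z) < δ}. Then the length of the intersection of the segment [x,y] with L_{μ,δ} satisfies ‖x − y‖ · Leb({t ∈ [0,1] : (1−t)x + ty ∈ L_{μ,δ}}) ≤ 16δ/m, where Leb denotes one-dimensional Lebesgue measure. -/

import Mathlib

open MeasureTheory Metric Set ProbabilityTheory
open scoped ENNReal NNReal

noncomputable section

/-- Euclidean space `ℝ^d`. -/
abbrev Euc (d : ℕ) := EuclideanSpace ℝ (Fin d)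

/-- The pseudo-distance-to-measure `δ_{μ,u}(x) = inf {r > 0 : μ(B(x,r)) > u}`. -/
def pseudoDTM {d : ℕ} (μ : Measure (Euc d)) (u : ℝ) (x : Euc d) : ℝ :=
  sInf {r : ℝ | 0 < r ∧ u < (μ (ball x r)).toReal}

/-- The distance-to-measure `d_μ(x) = ((1/m) ∫₀^m δ_{μ,u}(x)^p du)^{1/p}`. -/
def dtm {d : ℕ} (m p : ℝ) (μ : Measure (Euc d)) (x : Euc d) : ℝ :=
  ((1 / m) * ∫ u in Ioc (0 : ℝ) m, pseudoDTM μ u x ^ p) ^ (1 / p)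

/-- A Lipschitz path. -/
def IsLipschitzPath {d : ℕ} (γ : ℝ → Euc d) : Prop := ∃ K, LipschitzWith K γ

/-- Euclidean length `|γ| = ∫₀¹ ‖γ'(t)‖ dt`. -/
def eucLength {d : ℕ} (γ : ℝ → Euc d) : ℝ := ∫ t in Icc (0 : ℝ) 1, ‖deriv γ t‖

/-- FDTM length `D_μ(γ) = ∫₀¹ d_μ(γ(t))^β ‖γ'(t)‖ dt`. -/
def fdtmLength {d : ℕ} (m p β : ℝ) (μ : Measure (Euc d)) (γ : ℝ → Euc d) : ℝ :=
  ∫ t in Icc (0 : ℝ) 1, dtm m p μ (γ t) ^ β * ‖deriv γ t‖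

/-- Admissible paths `Γ_F(x,y)`: Lipschitz paths from `x` to `y` which may leave the domain `F`
only along straight lines. -/
def AdmissiblePath {d : ℕ} (F : Set (Euc d)) (x y : Euc d) (γ : ℝ → Euc d) : Prop :=
  IsLipschitzPath γ ∧ γ 0 = x ∧ γ 1 = y ∧
    ∀ a b : ℝ, 0 ≤ a → b ≤ 1 →
      (∀ t ∈ Ioo a b, γ t ∉ F) →
      ∃ u : Euc d, ‖u‖ = 1 ∧
        ∀ᵐ t ∂(volume.restrict (Ioo a b)), deriv γ t = ‖deriv γ t‖ • u

/-- The Fermat distance-to-measure `D_{μ,F}(x,y) = inf_{γ ∈ Γ_F(x,y)} D_μ(γ)`. -/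
def fdtm {d : ℕ} (m p β : ℝ) (μ : Measure (Euc d)) (F : Set (Euc d)) (x y : Euc d) : ℝ :=
  sInf {L : ℝ | ∃ γ : ℝ → Euc d, AdmissiblePath F x y γ ∧ L = fdtmLength m p β μ γ}

/-- A geodesic: an admissible path realizing the FDTM. -/
def IsGeodesic {d : ℕ} (m p β : ℝ) (μ : Measure (Euc d)) (F : Set (Euc d)) (x y : Euc d)
    (γ : ℝ → Euc d) : Prop :=
  AdmissiblePath F x y γ ∧ fdtmLength m p β μ γ = fdtm m p β μ F x y

/-- FDTM length of the straight segment `[x,y]`. -/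
def segFDTM {d : ℕ} (m p β : ℝ) (μ : Measure (Euc d)) (x y : Euc d) : ℝ :=
  ‖x - y‖ * ∫ t in Icc (0 : ℝ) 1, dtm m p μ ((1 - t) • x + t • y) ^ β

/-- The explicit constant `λ = 2·c·ρ^{β+1}/(ρ−1)` with `c = (16·5^β + 1152·165^β)/m^{2+β}`
and `ρ = 1 + 32/m`. -/
def fdtmConst (m β : ℝ) : ℝ :=
  2 * ((16 * (5 : ℝ) ^ β + 1152 * (165 : ℝ) ^ β) / m ^ (2 + β)) * (1 + 32 / m) ^ (β + 1) /
    ((1 + 32 / m) - 1)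

/-- Support of a measure: points all of whose neighborhoods have positive mass. -/
def measSupport {d : ℕ} (μ : Measure (Euc d)) : Set (Euc d) :=
  {x | ∀ r : ℝ, 0 < r → 0 < μ (ball x r)}

/-- `(a,b)`-standard measure: `μ(B(x,r)) ≥ a·r^b` for `x ∈ supp(μ)` and `0 < r ≤ a^{-1/b}`. -/
def IsStandard {d : ℕ} (μ : Measure (Euc d)) (a b : ℝ) : Prop :=
  ∀ x ∈ measSupport μ, ∀ r : ℝ, 0 < r → r ≤ a ^ (-(1 / b)) → a * r ^ b ≤ (μ (ball x r)).toReal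

/-- For a probability measure and `u < 1`, the radii in the definition of `pseudoDTM` exist. -/
lemma exists_lt_measure_ball {d : ℕ} (μ : Measure (Euc d)) [IsProbabilityMeasure μ] {u : ℝ}
    (hu : u < 1) (x : Euc d) : {r : ℝ | 0 < r ∧ u < (μ (ball x r)).toReal}.Nonempty := by
  have hmono : Monotone fun n : ℕ => ball x (n : ℝ) := fun a b hab =>
    ball_subset_ball (by exact_mod_cast hab)
  have ht := tendsto_measure_iUnion_atTop (μ := μ) hmono
  rw [iUnion_ball_nat, measure_univ] at ht
  have ht' := (ENNReal.tendsto_toReal ENNReal.one_ne_top).comp ht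
  rw [ENNReal.toReal_one] at ht'
  obtain ⟨n, hn, hpos⟩ :=
    ((ht'.eventually (lt_mem_nhds hu)).and (Filter.eventually_gt_atTop 0)).exists
  exact ⟨n, by exact_mod_cast hpos, hn⟩

lemma pseudoDTM_bddBelow {d : ℕ} (μ : Measure (Euc d)) (u : ℝ) (x : Euc d) :
    BddBelow {r : ℝ | 0 < r ∧ u < (μ (ball x r)).toReal} :=
  ⟨0, fun _ hr => hr.1.le⟩

lemma pseudoDTM_nonneg {d : ℕ} (μ : Measure (Euc d)) (u : ℝ) (x : Euc d) :
    0 ≤ pseudoDTM μ u x :=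
  Real.sInf_nonneg fun _ hr => hr.1.le

lemma pseudoDTM_mono {d : ℕ} (μ : Measure (Euc d)) [IsProbabilityMeasure μ] {u v : ℝ}
    (huv : u ≤ v) (hv : v < 1) (x : Euc d) : pseudoDTM μ u x ≤ pseudoDTM μ v x :=
  csInf_le_csInf (pseudoDTM_bddBelow μ u x) (exists_lt_measure_ball μ hv x)
    fun _ hr => ⟨hr.1, huv.trans_lt hr.2⟩

lemma integrableOn_pseudoDTM_rpow {d : ℕ} {m p : ℝ} (hm : m < 1) (hp : 0 ≤ p)
    (μ : Measure (Euc d)) [IsProbabilityMeasure μ] (x : Euc d) :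
    IntegrableOn (fun u => pseudoDTM μ u x ^ p) (Ioc 0 m) := by
  have hmono : MonotoneOn (fun u => pseudoDTM μ u x ^ p) (Icc 0 m) := fun u _ v hv huv =>
    Real.rpow_le_rpow (pseudoDTM_nonneg μ u x)
      (pseudoDTM_mono μ huv (hv.2.trans_lt hm) x) hp
  exact (hmono.integrableOn_isCompact isCompact_Icc).mono_set Ioc_subset_Icc_self

/-- Markov's inequality for the DTM. -/
lemma pseudoDTM_half_lt_of_dtm_lt {d : ℕ} {m p δ : ℝ} (hm : m ∈ Ioo (0 : ℝ) 1) (hp : 1 ≤ p)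
    (μ : Measure (Euc d)) [IsProbabilityMeasure μ] (hδ : 0 < δ) {z : Euc d}
    (hz : dtm m p μ z < δ) : pseudoDTM μ (m / 2) z < 2 * δ := by
  by_contra! h
  have hm0 := hm.1
  have hp0 : 0 < p := by linarith
  have hint := integrableOn_pseudoDTM_rpow hm.2 hp0.le μ z
  have hsub : Ioc (m / 2) m ⊆ Ioc 0 m := Ioc_subset_Ioc_left (by linarith)
  have hupper : ∫ _ in Ioc (m / 2) m, (2 * δ) ^ p ≤ ∫ u in Ioc 0 m, pseudoDTM μ u z ^ p := by
    refine le_trans (setIntegral_mono_on (by simp) (hint.mono_set hsub) measurableSet_Ioc ?_)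
      (setIntegral_mono_set hint ?_ hsub.eventuallyLE)
    · intro u hu
      exact Real.rpow_le_rpow (by positivity)
        (h.trans (pseudoDTM_mono μ hu.1.le (hu.2.trans_lt hm.2) z)) hp0.le
    · exact Filter.Eventually.of_forall fun u => Real.rpow_nonneg (pseudoDTM_nonneg μ u z) p
  rw [setIntegral_const, Real.volume_real_Ioc_of_le (by linarith), smul_eq_mul,
    Real.mul_rpow zero_le_two hδ.le] at hupper
  have h2 : (2 : ℝ) ≤ 2 ^ p := by
    simpa using Real.rpow_le_rpow_of_exponent_le one_le_two hp
  have hδp : 0 < δ ^ p := Real.rpow_pos_of_pos hδ p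
  have hlower : δ ^ p ≤ (1 / m) * ∫ u in Ioc 0 m, pseudoDTM μ u z ^ p := by
    rw [one_div, ← div_eq_inv_mul, le_div_iff₀ hm0]
    nlinarith [mul_le_mul_of_nonneg_right h2 (mul_pos hδp hm0).le]
  refine hz.not_ge ?_
  calc δ = (δ ^ p) ^ (1 / p) := by
        rw [← Real.rpow_mul hδ.le, mul_one_div_cancel hp0.ne', Real.rpow_one]
    _ ≤ dtm m p μ z := Real.rpow_le_rpow hδp.le hlower (by positivity)

lemma lt_measure_ball_of_pseudoDTM_lt {d : ℕ} (μ : Measure (Euc d)) [IsProbabilityMeasure μ]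
    {u r : ℝ} (hu0 : 0 ≤ u) (hu : u < 1) {z : Euc d} (h : pseudoDTM μ u z < r) :
    ENNReal.ofReal u < μ (ball z r) := by
  obtain ⟨s, hs, hsr⟩ := exists_lt_of_csInf_lt (exists_lt_measure_ball μ hu z) h
  refine lt_of_lt_of_le ?_ (measure_mono (ball_subset_ball hsr.le))
  exact (ENNReal.ofReal_lt_iff_lt_toReal hu0 (measure_ne_top μ _)).2 hs.2

/-- The set of times a segment spends in a ball has small measure. -/
lemma volume_segment_mem_ball_le {E : Type*} [NormedAddCommGroup E] [NormedSpace ℝ E] {x y : E}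
    (hxy : x ≠ y) (w : E) (R : ℝ) :
    volume {t : ℝ | w ∈ ball ((1 - t) • x + t • y) R} ≤ ENNReal.ofReal (2 * R / ‖x - y‖) := by
  refine (Real.volume_le_diam _).trans (Metric.ediam_le fun s hs t ht => ?_)
  rw [edist_dist]
  refine ENNReal.ofReal_le_ofReal ?_
  rw [le_div_iff₀ (norm_pos_iff.2 (sub_ne_zero.2 hxy)), Real.dist_eq, ← Real.norm_eq_abs,
    ← norm_smul]
  have hst : (s - t) • (x - y) =
      (w - ((1 - s) • x + s • y)) - (w - ((1 - t) • x + t • y)) := by module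
  rw [hst]
  rw [mem_ofPred_eq, mem_ball, dist_eq_norm] at hs ht
  linarith [norm_sub_le (w - ((1 - s) • x + s • y)) (w - ((1 - t) • x + t • y))]

lemma measurableSet_mem_ball_segment {d : ℕ} (x y : Euc d) (R : ℝ) :
    MeasurableSet {q : ℝ × Euc d | q.2 ∈ ball ((1 - q.1) • x + q.1 • y) R} := by
  simp only [mem_ball]
  exact (isOpen_lt (by fun_prop) (by fun_prop)).measurableSet

/-- The measure of balls centred along a segment, integrated along the segment. -/
lemma lintegral_measure_ball_segment_le {d : ℕ} (μ : Measure (Euc d)) [IsProbabilityMeasure μ]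
    {x y : Euc d} (hxy : x ≠ y) (R : ℝ) :
    ∫⁻ t : ℝ, μ (ball ((1 - t) • x + t • y) R) ≤ ENNReal.ofReal (2 * R / ‖x - y‖) := by
  have hS := measurableSet_mem_ball_segment x y R
  calc ∫⁻ t : ℝ, μ (ball ((1 - t) • x + t • y) R)
      = (volume.prod μ) {q : ℝ × Euc d | q.2 ∈ ball ((1 - q.1) • x + q.1 • y) R} :=
        (Measure.prod_apply hS).symm
    _ = ∫⁻ w, volume {t : ℝ | w ∈ ball ((1 - t) • x + t • y) R} ∂μ := Measure.prod_apply_symm hS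
    _ ≤ ∫⁻ _, ENNReal.ofReal (2 * R / ‖x - y‖) ∂μ :=
        lintegral_mono fun w => volume_segment_mem_ball_le hxy w R
    _ = ENNReal.ofReal (2 * R / ‖x - y‖) := by simp

lemma measurable_measure_ball_segment {d : ℕ} (μ : Measure (Euc d)) [IsProbabilityMeasure μ]
    (x y : Euc d) (R : ℝ) : Measurable fun t : ℝ => μ (ball ((1 - t) • x + t • y) R) :=
  measurable_measure_prodMk_left (measurableSet_mem_ball_segment x y R)

theorem segment_inter_dtm_sublevel {d : ℕ} (m p : ℝ) (hm : m ∈ Set.Ioo (0 : ℝ) 1) (hp : 1 ≤ p)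
    (μ : Measure (Euc d)) [IsProbabilityMeasure μ] (δ : ℝ) (hδ : 0 < δ) (x y : Euc d) :
    ‖x - y‖ * (volume {t ∈ Icc (0 : ℝ) 1 | dtm m p μ ((1 - t) • x + t • y) < δ}).toReal ≤
      16 * δ / m := by
  have hm0 := hm.1
  rcases eq_or_ne x y with rfl | hxy
  · rw [sub_self, norm_zero, zero_mul]
    positivity
  have hD : 0 < ‖x - y‖ := norm_pos_iff.2 (sub_ne_zero.2 hxy)
  have hsub : {t ∈ Icc (0 : ℝ) 1 | dtm m p μ ((1 - t) • x + t • y) < δ} ⊆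
      {t : ℝ | ENNReal.ofReal (m / 2) ≤ μ (ball ((1 - t) • x + t • y) (2 * δ))} := fun t ht =>
    (lt_measure_ball_of_pseudoDTM_lt μ (by linarith) (by linarith [hm.2])
      (pseudoDTM_half_lt_of_dtm_lt hm hp μ hδ ht.2)).le
  have hmarkov : ENNReal.ofReal (m / 2) *
      volume {t ∈ Icc (0 : ℝ) 1 | dtm m p μ ((1 - t) • x + t • y) < δ} ≤
      ENNReal.ofReal (2 * (2 * δ) / ‖x - y‖) :=
    (mul_le_mul_right (measure_mono hsub) _).trans <|
      (mul_meas_ge_le_lintegral (measurable_measure_ball_segment μ x y (2 * δ)) _).trans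
        (lintegral_measure_ball_segment_le μ hxy (2 * δ))
  have hreal := ENNReal.toReal_mono ENNReal.ofReal_ne_top hmarkov
  rw [ENNReal.toReal_mul, ENNReal.toReal_ofReal (by positivity),
    ENNReal.toReal_ofReal (by positivity), le_div_iff₀ hD] at hreal
  rw [le_div_iff₀ hm0]
  linarith

end
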